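/- Let A₆ be the alternating group of degree 6, H₁ = ⟨(3,5)(4,6), (1,2)(3,4,5,6), (1,4,6)⟩ ≤ A₆ (a subgroup of order 36), and let η be the degree-1 character of H₁ with η((1,2)(3,4,5,6)) = i (a primitive 4th root of unity), η((1,4,6)) = 1 and η((3,5)(4,6)) = −1. Then Ind_{H₁}^{A₆}(η) equals the irreducible character of A₆ of degree 10. -/

import Mathlib

open scoped Classical

/-- Induction of a class function `ψ` on a subgroup `H` of `G` to `G`. -/
noncomputable def indChar {G : Type} [Group G] [Fintype G] {K : Type} [Field K]
    (H : Subgroup G) (ψ : H → K) (g : G) : K :=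
  (Fintype.card H : K)⁻¹ * ∑ x : G, if h : x⁻¹ * g * x ∈ H then ψ ⟨x⁻¹ * g * x, h⟩ else 0

/-- The alternating group on the six letters `{1,…,6} ⊆ Fin 7`: even permutations of `Fin 7`
fixing `0`. -/
def A6 : Subgroup (Equiv.Perm (Fin 7)) :=
  alternatingGroup (Fin 7) ⊓ MulAction.stabilizer (Equiv.Perm (Fin 7)) (0 : Fin 7)

open CategoryTheory in
theorem simple_sub {K G : Type} [Field K] [Group G] (V : FDRep K G) (hV : Simple V)
    (W : Submodule K V) (hW : ∀ g, ∀ v ∈ W, V.ρ g v ∈ W) : W = ⊥ ∨ W = ⊤ := by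
  let r : Representation K G W :=
    { toFun := fun g => (V.ρ g).restrict (hW g)
      map_one' := by ext v; simp
      map_mul' := by intro a b; ext v; simp }
  let ι : FDRep.of r ⟶ V :=
    ⟨InducedCategory.homMk (ModuleCat.ofHom W.subtype), fun g => by
      ext v; rfl⟩
  by_cases h0 : W = ⊥
  · exact Or.inl h0
  right
  have hinj : Function.Injective ((forget (FDRep K G)).map ι) := Subtype.val_injective
  have : Mono ι := (forget (FDRep K G)).mono_of_mono_map ((mono_iff_injective _).2 hinj)
  have hne : ι ≠ 0 := by
    intro hz
    apply h0
    rw [Submodule.eq_bot_iff]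
    intro x hx
    have : ι.hom.hom.hom ⟨x, hx⟩ = (0 : FDRep.of r ⟶ V).hom.hom.hom ⟨x, hx⟩ := by rw [hz]
    exact this
  have : IsIso ι := isIso_of_mono_of_nonzero hne
  have hs : Function.Surjective ((forget (FDRep K G)).map ι) :=
    ((isIso_iff_bijective _).1 inferInstance).2
  rw [eq_top_iff]
  intro x _
  obtain ⟨y, hy⟩ := hs x
  rw [← hy]
  exact y.2

set_option linter.unusedSectionVars false

section generic
variable {K G M : Type} [Field K] [Group G] [Fintype G] [AddCommGroup M] [Module K M]
  [FiniteDimensional K M]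

theorem orbit_span (ρ : Representation K G M)
    (hirr : ∀ W : Submodule K M, (∀ g, ∀ v ∈ W, ρ g v ∈ W) → W = ⊥ ∨ W = ⊤)
    (H : Subgroup G) (θ : H → K) (w : M) (hw0 : w ≠ 0) (hw : ∀ h : H, ρ h w = θ h • w) :
    Submodule.span K (Set.range fun q : G ⧸ H => ρ q.out w) = ⊤ := by
  have key : ∀ g : G, ρ g w ∈ Submodule.span K (Set.range fun q : G ⧸ H => ρ q.out w) := by
    intro g
    obtain ⟨h, hh⟩ := QuotientGroup.mk_out_eq_mul H g
    have : g = (g : G ⧸ H).out * (h⁻¹ : H) := by rw [hh]; simp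
    rw [this, map_mul, Module.End.mul_apply, hw, map_smul]
    exact Submodule.smul_mem _ _ (Submodule.subset_span ⟨_, rfl⟩)
  refine (hirr _ ?_).resolve_left ?_
  · intro g v hv
    induction hv using Submodule.span_induction with
    | mem x hx =>
      obtain ⟨q, rfl⟩ := hx
      have := key (g * q.out)
      rwa [map_mul] at this
    | zero => simp
    | add x y _ _ hx hy => rw [map_add]; exact Submodule.add_mem _ hx hy
    | smul a x _ hx => rw [map_smul]; exact Submodule.smul_mem _ _ hx
  · intro hb
    apply hw0
    have := key 1
    rw [hb] at this
    simpa using this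

theorem finrank_le_index (ρ : Representation K G M)
    (hirr : ∀ W : Submodule K M, (∀ g, ∀ v ∈ W, ρ g v ∈ W) → W = ⊥ ∨ W = ⊤)
    (H : Subgroup G) (θ : H → K) (w : M) (hw0 : w ≠ 0) (hw : ∀ h : H, ρ h w = θ h • w) :
    Module.finrank K M ≤ H.index := by
  have h := orbit_span ρ hirr H θ w hw0 hw
  have h2 := finrank_range_le_card (R := K) (fun q : G ⧸ H => ρ q.out w)
  rw [Set.finrank, h, finrank_top] at h2
  rw [Subgroup.index, Nat.card_eq_fintype_card]
  exact h2

theorem orbit_li (ρ : Representation K G M)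
    (hirr : ∀ W : Submodule K M, (∀ g, ∀ v ∈ W, ρ g v ∈ W) → W = ⊥ ∨ W = ⊤)
    (H : Subgroup G) (θ : H → K) (w : M) (hw0 : w ≠ 0) (hw : ∀ h : H, ρ h w = θ h • w)
    (hidx : Module.finrank K M = H.index) :
    LinearIndependent K (fun q : G ⧸ H => ρ q.out w) := by
  have h := orbit_span ρ hirr H θ w hw0 hw
  refine linearIndependent_of_top_le_span_of_card_eq_finrank h.ge ?_
  rw [hidx, Subgroup.index, Nat.card_eq_fintype_card]

theorem ind_trace [CharZero K] (ρ : Representation K G M)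
    (hirr : ∀ W : Submodule K M, (∀ g, ∀ v ∈ W, ρ g v ∈ W) → W = ⊥ ∨ W = ⊤)
    (H : Subgroup G) (θ : H →* K) (w : M) (hw0 : w ≠ 0) (hw : ∀ h : H, ρ h w = θ h • w)
    (hidx : Module.finrank K M = H.index) (g : G) :
    LinearMap.trace K M (ρ g) = indChar H θ g := by
  have hs := orbit_span ρ hirr H θ w hw0 hw
  have hl := orbit_li ρ hirr H θ w hw0 hw hidx
  let b := Module.Basis.mk hl hs.ge
  have hb : ∀ q : G ⧸ H, b q = ρ q.out w := fun q => Module.Basis.mk_apply _ _ _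
  let F : G → K := fun x => if h : x⁻¹ * g * x ∈ H then θ ⟨x⁻¹ * g * x, h⟩ else 0
  have hF : ∀ (x : G) (h : H), F (x * h) = F x := by
    intro x h
    have e : (x * h)⁻¹ * g * (x * h) = (h : G)⁻¹ * (x⁻¹ * g * x) * h := by group
    have hiff : (x * h)⁻¹ * g * (x * h) ∈ H ↔ x⁻¹ * g * x ∈ H := by
      rw [e, H.mul_mem_cancel_right h.2, H.mul_mem_cancel_left (H.inv_mem h.2)]
    by_cases hx : x⁻¹ * g * x ∈ H
    · simp only [F]
      rw [dif_pos (hiff.2 hx), dif_pos hx]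
      have e2 : (⟨(x * h)⁻¹ * g * (x * h), hiff.2 hx⟩ : H) = h⁻¹ * ⟨x⁻¹ * g * x, hx⟩ * h :=
        Subtype.ext e
      rw [e2, map_mul, map_mul, mul_right_comm, ← map_mul]
      simp
    · simp only [F]
      rw [dif_neg (fun hh => hx (hiff.1 hh)), dif_neg hx]
  have hdiag : ∀ q : G ⧸ H, b.repr (ρ g (b q)) q = F q.out := by
    intro q
    rw [hb]
    obtain ⟨h, hh⟩ := QuotientGroup.mk_out_eq_mul H (g * q.out)
    set q' : G ⧸ H := ((g * q.out : G) : G ⧸ H) with hq'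
    have e1 : ρ g (ρ q.out w) = θ h⁻¹ • b q' := by
      have : g * q.out = q'.out * (h⁻¹ : H) := by rw [hh]; simp
      rw [← Module.End.mul_apply, ← map_mul, this, map_mul, Module.End.mul_apply, hw, map_smul, hb]
    rw [e1, map_smul, Finsupp.smul_apply, Module.Basis.repr_self]
    have hiff : q' = q ↔ q.out⁻¹ * g * q.out ∈ H := by
      conv_lhs => rw [← QuotientGroup.out_eq' q, hq', eq_comm, QuotientGroup.eq]
      rw [mul_assoc]
    by_cases hqq : q' = q
    · have hm := hiff.1 hqq
      simp only [F]
      rw [dif_pos hm, hqq, Finsupp.single_eq_same, smul_eq_mul, mul_one]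
      congr 1
      apply Subtype.ext
      simp only [Subgroup.coe_inv]
      rw [hqq] at hh
      have : (h : G) = (g * q.out)⁻¹ * q.out := eq_inv_mul_of_mul_eq hh.symm
      rw [this]; group
    · simp only [F]
      rw [dif_neg (fun hm => hqq (hiff.2 hm)), Finsupp.single_eq_of_ne (Ne.symm hqq), smul_zero]
  have htr : LinearMap.trace K M (ρ g) = ∑ q : G ⧸ H, F q.out := by
    rw [LinearMap.trace_eq_matrix_trace K b, Matrix.trace]
    refine Finset.sum_congr rfl fun q _ => ?_
    rw [Matrix.diag_apply, LinearMap.toMatrix_apply, hdiag]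
  have hsum : ∑ x : G, F x = (Fintype.card H : K) * ∑ q : G ⧸ H, F q.out := by
    have hbij : Function.Bijective (fun p : (G ⧸ H) × H => p.1.out * (p.2 : G)) := by
      constructor
      · rintro ⟨q, h⟩ ⟨q', h'⟩ hp
        simp only at hp
        have e : ∀ (q : G ⧸ H) (h : H), ((q.out * (h : G) : G) : G ⧸ H) = q := by
          intro q h
          rw [QuotientGroup.mk_mul_of_mem _ h.2, QuotientGroup.out_eq']
        have hq : q = q' := by rw [← e q h, hp, e]
        subst hq
        rw [mul_right_inj] at hp
        rw [Subtype.ext hp]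
      · intro g
        obtain ⟨h, hh⟩ := QuotientGroup.mk_out_eq_mul H g
        exact ⟨((g : G ⧸ H), h⁻¹), by simp [hh]⟩
    rw [← hbij.sum_comp F, Fintype.sum_prod_type, Finset.mul_sum]
    refine Finset.sum_congr rfl fun q _ => ?_
    simp [hF]
  have hc : (Fintype.card H : K) ≠ 0 := by exact_mod_cast Fintype.card_ne_zero
  rw [htr, indChar]
  change _ = _ * ∑ x : G, F x
  rw [hsum, inv_mul_cancel_left₀ hc]

theorem fixed_zero (ρ : Representation K G M)
    (hirr : ∀ W : Submodule K M, (∀ g, ∀ v ∈ W, ρ g v ∈ W) → W = ⊥ ∨ W = ⊤)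
    (H : Subgroup G) (hidx : H.index < Module.finrank K M) (w : M) (hw : ∀ h ∈ H, ρ h w = w) :
    w = 0 := by
  by_contra hw0
  have := finrank_le_index ρ hirr H (fun _ => 1) w hw0 (fun h => by rw [one_smul]; exact hw h h.2)
  omega

/-- no fixed vector when the index equals the dimension (which is at least two) -/
theorem fixed_zero' (ρ : Representation K G M)
    (hirr : ∀ W : Submodule K M, (∀ g, ∀ v ∈ W, ρ g v ∈ W) → W = ⊥ ∨ W = ⊤)
    (H : Subgroup G) (hidx : Module.finrank K M = H.index) (h2 : 1 < Module.finrank K M)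
    (w : M) (hw : ∀ h ∈ H, ρ h w = w) : w = 0 := by
  by_contra hw0
  have hl := orbit_li ρ hirr H (fun _ => 1) w hw0
    (fun h => by rw [one_smul]; exact hw h h.2) hidx
  have hout : ∀ g : G, ρ (g : G ⧸ H).out w = ρ g w := by
    intro g
    obtain ⟨h, hh⟩ := QuotientGroup.mk_out_eq_mul H g
    rw [hh, map_mul, Module.End.mul_apply, hw _ h.2]
  have hz : ∑ q : G ⧸ H, ρ q.out w = 0 := by
    refine fixed_zero ρ hirr ⊤ (by rw [Subgroup.index_top]; exact h2) _ fun g _ => ?_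
    rw [map_sum, ← Equiv.sum_comp (MulAction.toPerm g : Equiv.Perm (G ⧸ H))
      (fun q => ρ q.out w)]
    refine Finset.sum_congr rfl fun q _ => ?_
    rw [← Module.End.mul_apply, ← map_mul, ← hout]
    congr 3
    rw [MulAction.toPerm_apply]
    conv_rhs => rw [← QuotientGroup.out_eq' q]
    rfl
  have := Fintype.linearIndependent_iff.1 hl (fun _ => 1) (by simpa using hz) ((1 : G) : G ⧸ H)
  exact one_ne_zero this

/-- a projection onto the fixed space of an element of order three has integral trace -/
theorem trace_three [CharZero K] (ρ : Representation K G M) (x : G) (hx : x * x * x = 1) :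
    ∃ n : ℕ, (Module.finrank K M : K) + LinearMap.trace K M (ρ x)
      + LinearMap.trace K M (ρ (x * x)) = 3 * n := by
  let A := ρ x
  have hA : A * A * A = 1 := by rw [← map_mul, ← map_mul, hx, map_one]
  let P : Module.End K M := (3 : K)⁻¹ • (1 + A + A * A)
  have hsq : (1 + A + A * A) * (1 + A + A * A) = (3 : K) • (1 + A + A * A) := by
    have e1 : A * (A * A) = 1 := by rw [← mul_assoc, hA]
    have e2 : A * A * (A * A) = A := by rw [← mul_assoc, hA, one_mul]
    simp only [mul_add, add_mul, one_mul, mul_one, hA, e1, e2]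
    module
  have hP : IsIdempotentElem P := by
    change P * P = P
    simp only [P]
    rw [smul_mul_smul_comm, hsq, smul_smul]
    congr 1
    norm_num
  have ht := (LinearMap.IsIdempotentElem.isProj_range P hP).trace
  refine ⟨Module.finrank K (LinearMap.range P), ?_⟩
  rw [← ht]
  simp only [P, map_smul, map_add, LinearMap.trace_one, smul_eq_mul, map_mul, A]
  ring

end generic

section words

/-- the letters -/
def letterP : ℕ → Equiv.Perm (Fin 7)
  | 0 => c[(1 : Fin 7), 2] * c[(3 : Fin 7), 4, 5, 6]
  | 1 => c[(1 : Fin 7), 4, 6]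
  | 2 => c[(1 : Fin 7), 2, 3, 4, 5]
  | 3 => c[(1 : Fin 7), 2, 3]
  | _ => c[(1 : Fin 7), 2, 3] * c[(4 : Fin 7), 6, 5]

/-- the tables of the letters -/
def letterT : ℕ → List ℕ
  | 0 => [0, 2, 1, 4, 5, 6, 3]
  | 1 => [0, 4, 2, 3, 6, 5, 1]
  | 2 => [0, 2, 3, 4, 5, 1, 6]
  | 3 => [0, 2, 3, 1, 4, 5, 6]
  | _ => [0, 2, 3, 1, 6, 4, 5]

theorem letterP_mem (n : ℕ) : letterP n ∈ A6 := by
  rw [A6, Subgroup.mem_inf, Equiv.Perm.mem_alternatingGroup, MulAction.mem_stabilizer_iff,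
    Equiv.Perm.smul_def]
  rcases n with _ | _ | _ | _ | n <;> exact ⟨by simp only [letterP]; decide +kernel, by simp only [letterP]; decide +kernel⟩

theorem letterT_eq (n : ℕ) (i : Fin 7) : (letterT n).getD i 0 = (letterP n i : ℕ) := by
  revert i
  rcases n with _ | _ | _ | _ | n <;> simp only [letterP, letterT] <;> decide +kernel

/-- a letter as an element of the group -/
def letterA (n : ℕ) : A6 := ⟨letterP n, letterP_mem n⟩

/-- the value of a word -/
def ev (w : List ℕ) : A6 := (w.map letterA).prod

/-- the value of a word as a table -/
def evc : List ℕ → List ℕ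
  | [] => [0, 1, 2, 3, 4, 5, 6]
  | l :: w => (evc w).map fun i => (letterT l).getD i 0

theorem evc_eq (w : List ℕ) :
    evc w = List.ofFn (fun i : Fin 7 => (((ev w : A6) : Equiv.Perm (Fin 7)) i : ℕ)) := by
  induction w with
  | nil => simp [evc, ev]
  | cons l w ih =>
    rw [evc, ih, List.map_ofFn]
    congr 1
    funext i
    simp only [Function.comp]
    rw [letterT_eq]
    simp [ev, letterA]

theorem ev_eq {w w' : List ℕ} (h : evc w = evc w') : ev w = ev w' := by
  rw [evc_eq, evc_eq] at h
  have := List.ofFn_injective h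
  apply Subtype.ext
  ext i
  exact congrFun this i

theorem ev_append (w w' : List ℕ) : ev (w ++ w') = ev w * ev w' := by simp [ev]
theorem ev_cons (l : ℕ) (w : List ℕ) : ev (l :: w) = letterA l * ev w := by simp [ev]

/-- class representatives -/
def rep : ℕ → List ℕ
  | 0 => []
  | 1 => [0, 0]
  | 2 => [1]
  | 3 => [1, 0, 1, 0, 0, 0]
  | 4 => [0]
  | 5 => [2]
  | _ => [2, 2]

/-- key of a word: its value and the exponent of its weight -/
def key (w : List ℕ) : List ℕ × ℕ := (evc w, w.count 0 % 4)

/-- conjugacy check -/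
def chkConj (t : List ℕ) (L : List (List ℕ × ℕ × List ℕ)) : Bool :=
  L.all fun d => evc (d.2.2 ++ d.1 ++ t) == evc (rep d.2.1 ++ d.2.2)

/-- closure check -/
def chkPerm (l : ℕ) (L : List (List ℕ × ℕ × List ℕ)) : Bool :=
  ((L.map fun d => key (l :: d.1)).isPerm (L.map fun d => key d.1))

/-- words with conjugacy data -/
def LH : List (List ℕ × ℕ × List ℕ) := [
  ([], 0, []), ([0, 0], 1, []), ([1, 0, 0], 1, [1]), ([0, 1, 0], 1, [3]), ([0, 0, 1], 1, [1, 1]),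
  ([1, 0, 1, 0], 1, [3, 1]), ([0, 1, 1, 0], 1, [1, 0]), ([0, 1, 0, 1], 1, [3, 1, 1]),
  ([1, 0, 1, 1, 0], 1, [3, 1, 0]), ([0, 1, 1, 0, 1], 1, [2, 2, 3]), ([1], 2, []),
  ([1, 1], 2, [0, 0]), ([0, 1, 0, 0, 0], 2, [0, 0, 0]), ([0, 0, 0, 1, 0], 2, [0]),
  ([1, 0, 1, 0, 0, 0], 3, []), ([0, 1, 0, 1, 0, 0], 3, [0, 0, 0]), ([1, 0, 0, 0, 1, 0], 3, [0]),
  ([0, 0, 1, 0, 1, 0], 3, [0, 0]), ([0], 4, []), ([1, 0], 4, [1, 1, 0, 1]),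
  ([0, 1], 4, [2, 2, 3, 0]), ([0, 0, 0], 4, [3, 0, 1, 1]), ([1, 1, 0], 4, [2, 2, 3]),
  ([1, 0, 1], 4, [1, 0]), ([0, 1, 1], 4, [1, 0, 1]), ([1, 0, 0, 0], 4, [3, 1, 0]),
  ([0, 1, 0, 0], 4, [3, 1]), ([0, 0, 1, 0], 4, [3, 1, 1]), ([0, 0, 0, 1], 4, [3, 1, 0, 0]),
  ([1, 1, 0, 1], 4, [1]), ([1, 0, 1, 1], 4, [1, 1]), ([1, 0, 1, 0, 0], 4, [3, 0, 1]),
  ([0, 1, 0, 1, 0], 4, [3, 0, 0]), ([1, 0, 0, 0, 1], 4, [3]), ([0, 0, 1, 0, 1], 4, [3, 0]),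
  ([1, 1, 0, 1, 1], 4, [1, 1, 0])]

/-- words with conjugacy data -/
def LA : List (List ℕ × ℕ × List ℕ) := [
  ([], 0, []), ([3, 2, 2], 1, [1, 2]), ([2, 3, 2], 1, [1]), ([2, 2, 3], 1, [3, 1]),
  ([2, 3, 3, 2, 2], 1, [1, 3, 1]), ([2, 2, 3, 3, 2], 1, [4, 1, 0]), ([3, 2, 2, 2, 3], 1, [4, 0]),
  ([3, 3, 2, 3, 2, 3], 1, [1, 3]), ([3, 2, 3, 2, 3, 3], 1, [4, 1]),
  ([3, 2, 3, 2, 2, 2, 2], 1, [2, 1]), ([2, 3, 2, 3, 2, 2, 2], 1, [4, 4, 0]),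
  ([3, 3, 2, 3, 2, 2, 2], 1, [2, 3, 0]), ([2, 3, 2, 3, 3, 2, 2], 1, [1, 0, 4]),
  ([3, 2, 3, 2, 3, 3, 2], 1, [3, 1, 0]), ([3, 2, 3, 2, 2, 2, 3], 1, [1, 2, 1]),
  ([3, 2, 3, 2, 3, 3, 2, 2], 1, [4, 1, 2]), ([3], 2, [0, 3, 0, 0]), ([3, 3], 2, [0, 2, 0]),
  ([3, 3, 2], 2, [2, 1]), ([3, 2, 3], 2, [2, 3, 1]), ([2, 3, 3], 2, [2, 0, 1]),
  ([3, 2, 2, 2, 2], 2, [2, 3, 0]), ([2, 3, 2, 2, 2], 2, [0, 4, 0]), ([2, 2, 2, 3, 2], 2, [4, 2]),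
  ([2, 2, 2, 2, 3], 2, [4]), ([2, 3, 2, 2, 2, 2], 2, [3, 2, 1]),
  ([3, 2, 3, 2, 2, 2], 2, [2, 2, 0]), ([2, 3, 2, 3, 2, 2], 2, [0, 3, 0]),
  ([3, 3, 2, 3, 2, 2], 2, [4, 3]), ([3, 2, 3, 3, 2, 2], 2, [0, 0, 0]),
  ([2, 2, 2, 2, 3, 2], 2, [0, 3]), ([3, 2, 2, 2, 3, 2], 2, [0, 2]),
  ([2, 3, 2, 3, 3, 2], 2, [3, 1]), ([2, 3, 2, 2, 2, 3], 2, [0]),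
  ([2, 3, 2, 3, 2, 2, 2, 2], 2, [4, 1]), ([3, 3, 2, 3, 2, 2, 2, 2], 2, [4, 0, 1]), ([2], 5, []),
  ([2, 2, 2, 2], 5, [1, 1, 3, 0]), ([3, 2, 3, 2], 5, [4, 2, 0]), ([2, 3, 2, 3], 5, [3, 3, 2]),
  ([3, 3, 2, 3], 5, [3]), ([3, 2, 3, 3], 5, [3, 3]), ([3, 2, 3, 2, 2], 5, [3, 0, 4]),
  ([2, 3, 2, 3, 2], 5, [4, 0, 1, 0]), ([3, 3, 2, 3, 2], 5, [1, 2, 0]),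
  ([3, 2, 3, 3, 2], 5, [3, 1, 0, 0]), ([3, 2, 3, 2, 3], 5, [3, 2]),
  ([2, 3, 2, 3, 3], 5, [3, 2, 3]), ([2, 2], 6, []), ([3, 2], 6, [3, 2, 3]),
  ([2, 3], 6, [1, 2, 0]), ([2, 2, 2], 6, [1, 1, 3, 0]), ([3, 2, 2, 2], 6, [3]),
  ([2, 3, 2, 2], 6, [4, 2, 0]), ([3, 3, 2, 2], 6, [3, 0, 4]), ([2, 2, 3, 2], 6, [3, 3, 2]),
  ([2, 3, 3, 2], 6, [4, 0, 1, 0]), ([2, 2, 2, 3], 6, [3, 3]), ([2, 2, 3, 3], 6, [3, 1, 0, 0]),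
  ([3, 3, 2, 3, 3], 6, [3, 2])]

/-- words with conjugacy data -/
def LAt : List (List ℕ × ℕ × List ℕ) := [
  ([3, 3, 2, 2], 1, [4, 4]), ([2, 3, 3, 2], 1, [2, 0]), ([3, 3, 2, 3, 2], 1, [1, 1, 2]),
  ([3, 2, 3, 3, 2], 1, [3, 2, 0]), ([2, 2, 2, 2, 3], 1, [4, 1, 1]),
  ([3, 2, 3, 2, 2, 2, 3], 1, [4, 3, 2]), ([2, 2, 2, 2], 2, [0, 3, 1]),
  ([2, 3, 2, 2], 2, [4, 0, 2, 0]), ([3, 2, 3, 2, 2, 2, 2], 2, [3, 0, 0]),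
  ([2, 3, 2, 3, 3, 2, 2], 2, [3, 0]), ([2, 2, 2], 3, [4, 2]), ([3, 2, 3], 3, [0, 3, 0]),
  ([2, 3, 3], 3, [3, 0]), ([2, 3, 3, 2, 2], 3, [4, 0, 2, 0]), ([2, 3, 2, 3, 3], 3, [0, 3, 1]),
  ([2, 3, 2, 2, 2, 2], 3, [3, 0, 0]), ([3, 3, 2, 3, 2, 2, 2], 3, [4, 0, 1]),
  ([3, 3, 2, 3, 2, 2, 2, 2], 3, [0, 3, 0, 0]), ([], 4, []), ([2, 2], 4, [2, 1]),
  ([2, 3], 4, [4, 2, 0]), ([3, 2, 2], 4, [4, 1, 0]), ([2, 3, 2], 4, [3, 1, 0]),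
  ([3, 3, 2], 4, [2, 0, 1]), ([2, 2, 3], 4, [3, 0, 1]), ([3, 2, 3, 2], 4, [1, 0, 4, 0]),
  ([2, 2, 3, 3], 4, [4]), ([3, 2, 3, 3], 4, [3, 2, 3, 0]), ([2, 2, 3, 3, 2], 4, [3, 3]),
  ([3, 2, 3, 2, 3], 4, [4, 3]), ([3, 2, 3, 2, 2, 2], 4, [2, 1, 0, 2]),
  ([3, 2, 3, 3, 2, 2], 4, [2, 2, 3, 0]), ([2, 3, 2, 2, 2, 3], 4, [1, 0, 1]),
  ([3, 2, 3, 2, 3, 3], 4, [3, 0, 4]), ([3, 2, 3, 2, 3, 3, 2], 4, [3]),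
  ([2, 3, 2, 3, 2, 2, 2, 2], 4, [2, 1, 3]), ([2], 5, [4, 0, 4]), ([3], 5, [1, 0, 2]),
  ([2, 2, 2, 3], 5, [4, 2, 4, 0]), ([3, 2, 2, 2, 2], 5, [4]), ([3, 2, 3, 2, 2], 5, [1]),
  ([2, 2, 2, 3, 2], 5, [4, 0]), ([2, 3, 2, 3, 2], 5, [4, 2, 1]),
  ([3, 3, 2, 3, 3], 5, [1, 2, 3, 0]), ([2, 3, 2, 3, 2, 2], 5, [1, 0, 4, 0]),
  ([2, 2, 2, 2, 3, 2], 5, [1, 0, 4]), ([3, 3, 2, 3, 2, 3], 5, [1, 0, 1]),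
  ([3, 2, 3, 2, 3, 3, 2, 2], 5, [1, 3]), ([3, 2], 6, [1, 0, 2, 0]), ([3, 3], 6, [4, 4, 0, 1]),
  ([3, 2, 2, 2], 6, [1, 2]), ([2, 2, 3, 2], 6, [3, 1]), ([2, 3, 2, 3], 6, [4, 2, 2]),
  ([3, 3, 2, 3], 6, [1, 2, 3]), ([2, 3, 2, 2, 2], 6, [1, 3, 1]), ([3, 2, 2, 2, 3], 6, [1, 0]),
  ([3, 3, 2, 3, 2, 2], 6, [0, 3, 2]), ([3, 2, 2, 2, 3, 2], 6, [1, 3, 1, 0]),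
  ([2, 3, 2, 3, 3, 2], 6, [0, 3, 2, 0]), ([2, 3, 2, 3, 2, 2, 2], 6, [0, 1, 2])]

/-- words with conjugacy data -/
def LB : List (List ℕ × ℕ × List ℕ) := [
  ([], 0, []), ([4, 4, 2], 1, []), ([4, 2, 4], 1, [4]), ([2, 4, 4], 1, [4, 4]),
  ([2, 4, 2, 2, 2], 1, [3, 1, 1]), ([2, 2, 4, 2, 2], 1, [2, 2]), ([2, 2, 2, 4, 2], 1, [2]),
  ([4, 4, 2, 2, 4, 2], 1, [4, 2]), ([4, 2, 4, 2, 2, 4], 1, [4, 1]),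
  ([4, 2, 2, 4, 2, 4], 1, [1, 3]), ([2, 4, 2, 2, 4, 4], 1, [4, 1, 4]),
  ([2, 4, 2, 2, 4, 2, 2], 1, [1, 0, 3]), ([2, 2, 4, 2, 2, 4, 2], 1, [3, 2, 0]),
  ([4, 2, 4, 2, 2, 4, 2], 1, [3, 1, 0]), ([2, 4, 2, 2, 4, 2, 4], 1, [1, 2, 1]),
  ([4, 2, 4, 2, 2, 4, 2, 2], 1, [4, 1, 2]), ([4], 3, [2, 0]), ([4, 4], 3, [3, 0, 0]),
  ([4, 2, 2, 2], 3, [3, 2, 0]), ([2, 4, 2, 2], 3, [0, 4]), ([4, 4, 2, 2], 3, [4, 0]),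
  ([2, 2, 4, 2], 3, [3, 2]), ([2, 2, 2, 4], 3, [3]), ([4, 2, 2, 4], 3, [2, 3, 1]),
  ([2, 2, 4, 4], 3, [4, 0, 2, 0]), ([4, 2, 4, 2, 2], 3, [4, 0, 1]),
  ([4, 2, 2, 4, 2], 3, [0, 3, 0]), ([2, 4, 2, 2, 4], 3, [0, 0, 0]), ([2, 2, 4, 2, 4], 3, [4, 1]),
  ([4, 2, 4, 2, 4], 3, [4, 3]), ([2, 2, 4, 2, 2, 2], 3, [0, 2, 1]),
  ([4, 2, 4, 2, 2, 2], 3, [2, 2, 0]), ([2, 2, 2, 4, 2, 2], 3, [4, 0, 2]),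
  ([2, 2, 2, 4, 2, 4], 3, [3, 1]), ([4, 4, 2, 2, 4, 2, 4], 3, [0, 2]),
  ([4, 2, 4, 2, 2, 4, 4], 3, [0]), ([2], 5, []), ([4, 2], 5, [3, 0, 3, 2]),
  ([2, 4], 5, [3, 0, 3]), ([4, 2, 2], 5, [3, 1, 1]), ([2, 4, 2], 5, [4, 2, 2]),
  ([2, 2, 4], 5, [4, 2]), ([2, 2, 2, 2], 5, [1, 1, 3, 0]), ([4, 4, 2, 4], 5, [4]),
  ([4, 2, 4, 4], 5, [4, 4]), ([4, 4, 2, 2, 2], 5, [0, 3, 2, 0]),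
  ([2, 2, 2, 4, 4], 5, [1, 2, 3, 0]), ([4, 4, 2, 2, 4, 4], 5, [4, 2, 4]), ([2, 2], 6, []),
  ([2, 2, 2], 6, [1, 1, 3, 0]), ([4, 2, 4, 2], 6, [3, 0, 3, 2]), ([2, 4, 2, 4], 6, [3, 0, 3]),
  ([4, 4, 2, 2, 4], 6, [4]), ([4, 2, 2, 4, 4], 6, [4, 4]), ([4, 2, 2, 4, 2, 2], 6, [3, 1, 1]),
  ([2, 4, 2, 2, 4, 2], 6, [4, 2, 2]), ([2, 2, 4, 2, 2, 4], 6, [4, 2]),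
  ([4, 4, 2, 2, 4, 2, 2], 6, [0, 3, 2, 0]), ([2, 2, 4, 2, 2, 4, 4], 6, [1, 2, 3, 0]),
  ([2, 2, 4, 2, 2, 4, 2, 2], 6, [4, 2, 4])]

theorem conj_LH : chkConj [] LH = true := by decide +kernel
theorem conj_LA : chkConj [] LA = true := by decide +kernel
theorem conj_LAt : chkConj [0] LAt = true := by decide +kernel
theorem conj_LB : chkConj [] LB = true := by decide +kernel
theorem perm_LH0 : chkPerm 0 LH = true := by decide +kernel
theorem perm_LH1 : chkPerm 1 LH = true := by decide +kernel
theorem perm_LA2 : chkPerm 2 LA = true := by decide +kernel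
theorem perm_LA3 : chkPerm 3 LA = true := by decide +kernel
theorem perm_LAt2 : chkPerm 2 LAt = true := by decide +kernel
theorem perm_LAt3 : chkPerm 3 LAt = true := by decide +kernel
theorem perm_LB2 : chkPerm 2 LB = true := by decide +kernel
theorem perm_LB4 : chkPerm 4 LB = true := by decide +kernel
theorem nodup_LA : (LA.map fun d => evc d.1).Nodup := by decide +kernel
theorem nodup_LAt : (LAt.map fun d => evc d.1).Nodup := by decide +kernel
theorem nodup_LB : (LB.map fun d => evc d.1).Nodup := by decide +kernel
theorem let_LA : ∀ d ∈ LA, ∀ l ∈ d.1, l = 2 ∨ l = 3 := by decide +kernel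
theorem let_LAt : ∀ d ∈ LAt, ∀ l ∈ d.1, l = 2 ∨ l = 3 := by decide +kernel
theorem let_LB : ∀ d ∈ LB, ∀ l ∈ d.1, l = 2 ∨ l = 4 := by decide +kernel

end words

theorem card_A6_le : Nat.card A6 ≤ 360 := by
  have h1 : Nat.card (MulAction.stabilizer (Equiv.Perm (Fin 7)) (0 : Fin 7)) = 720 := by
    have h := MulAction.index_stabilizer_of_transitive (Equiv.Perm (Fin 7)) (0 : Fin 7)
    have h2 := (MulAction.stabilizer (Equiv.Perm (Fin 7)) (0 : Fin 7)).card_mul_index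
    rw [h, Nat.card_eq_fintype_card (α := Fin 7), Nat.card_eq_fintype_card (α := Equiv.Perm (Fin 7)),
      Fintype.card_perm, Fintype.card_fin] at h2
    have : Nat.factorial 7 = 5040 := by decide
    omega
  have hle : A6 ≤ MulAction.stabilizer (Equiv.Perm (Fin 7)) (0 : Fin 7) := inf_le_right
  have hdvd := Subgroup.card_dvd_of_le hle
  rw [h1] at hdvd
  have hne : Nat.card A6 ≠ 720 := by
    intro h
    have heq : A6 = MulAction.stabilizer (Equiv.Perm (Fin 7)) (0 : Fin 7) :=
      Subgroup.eq_of_le_of_card_ge hle (by rw [h, h1])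
    have hm : Equiv.swap (1 : Fin 7) 2 ∈ A6 := by
      rw [heq, MulAction.mem_stabilizer_iff]; decide
    rw [A6, Subgroup.mem_inf, Equiv.Perm.mem_alternatingGroup] at hm
    exact absurd hm.1 (by decide +kernel)
  obtain ⟨k, hk⟩ := hdvd
  rcases k with _ | _ | k
  · omega
  · omega
  · nlinarith

section ops
variable {K M : Type} [Field K] [AddCommGroup M] [Module K M] [FiniteDimensional K M]

/-- the weighted sum of the operators of a list of words -/
noncomputable def op (ρ : Representation K A6 M) (z : K) (L : List (List ℕ × ℕ × List ℕ)) :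
    Module.End K M :=
  (L.map fun d => z ^ (d.1.count 0) • ρ (ev d.1)).sum

theorem op_letter (ρ : Representation K A6 M) (z : K) (hz : z ^ 4 = 1)
    (L : List (List ℕ × ℕ × List ℕ)) (l : ℕ) (h : chkPerm l L = true) :
    z ^ ([l].count 0) • (ρ (letterA l) * op ρ z L) = op ρ z L := by
  let f : List ℕ → Module.End K M := fun w => z ^ (w.count 0) • ρ (ev w)
  have hf : Function.FactorsThrough f key := by
    intro a b hab
    simp only [key, Prod.mk.injEq] at hab
    simp only [f]
    rw [ev_eq hab.1, pow_eq_pow_mod (a.count 0) hz, pow_eq_pow_mod (b.count 0) hz, hab.2]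
  have hp := List.isPerm_iff.1 h
  have hs := (hp.map (Function.extend key f 0)).sum_eq
  simp only [List.map_map] at hs
  have e : ∀ w, Function.extend key f 0 (key w) = f w := fun w => hf.extend_apply 0 w
  simp only [Function.comp_def, e] at hs
  change _ = (L.map fun d => f d.1).sum
  rw [← hs, op, ← List.sum_map_mul_left, List.smul_sum, List.map_map]
  congr 1
  refine List.map_congr_left fun d _ => ?_
  simp only [f, Function.comp, ev_cons, map_mul]
  rw [mul_smul_comm, smul_smul, ← pow_add, ← List.count_append]
  rfl

theorem trace_op (ρ : Representation K A6 M) (z : K) (t : List ℕ)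
    (L : List (List ℕ × ℕ × List ℕ)) (h : chkConj t L = true) (h0 : op ρ z L = 0) :
    (L.map fun d => z ^ (d.1.count 0) * LinearMap.trace K M (ρ (ev (rep d.2.1)))).sum = 0 := by
  have h1 : LinearMap.trace K M (op ρ z L * ρ (ev t)) = 0 := by rw [h0]; simp
  rw [← h1, op, ← List.sum_map_mul_right, map_list_sum, List.map_map]
  congr 1
  refine List.map_congr_left fun d hd => ?_
  have hc := List.all_eq_true.1 h d hd
  have hc := ev_eq (beq_iff_eq.1 hc)
  rw [List.append_assoc, ev_append, ev_append, ev_append] at hc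
  simp only [Function.comp]
  rw [smul_mul_assoc, map_smul, smul_eq_mul, ← map_mul]
  congr 1
  have : ev (rep d.2.1) = ev d.2.2 * (ev d.1 * ev t) * (ev d.2.2)⁻¹ := by rw [hc]; group
  rw [this, map_mul, LinearMap.trace_mul_comm, ← map_mul, inv_mul_cancel_left]

theorem op_zero (ρ : Representation K A6 M)
    (hirr : ∀ W : Submodule K M, (∀ g, ∀ v ∈ W, ρ g v ∈ W) → W = ⊥ ∨ W = ⊤)
    (hdim : Module.finrank K M = 10)
    (L : List (List ℕ × ℕ × List ℕ)) (a b : ℕ) (ha : chkPerm a L = true) (hb : chkPerm b L = true)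
    (hL : ∀ d ∈ L, ∀ l ∈ d.1, l = a ∨ l = b) (hn : (L.map fun d => evc d.1).Nodup)
    (hlen : L.length = 60) : op ρ 1 L = 0 := by
  ext v
  let w := op ρ 1 L v
  have hw : ∀ l, chkPerm l L = true → ρ (letterA l) w = w := by
    intro l hl
    have := op_letter ρ 1 (one_pow 4) L l hl
    rw [one_pow, one_smul] at this
    exact congrArg (fun f => f v) this
  let S : Subgroup A6 :=
    { carrier := {g | ρ g w = w}
      one_mem' := by simp
      mul_mem' := by
        intro x y hx hy
        simp only [Set.mem_ofPred_eq] at hx hy ⊢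
        rw [map_mul, Module.End.mul_apply, hy, hx]
      inv_mem' := by
        intro x hx
        simp only [Set.mem_ofPred_eq] at hx ⊢
        conv_lhs => rw [← hx]
        simp }
  have hmem : ∀ u : List ℕ, (∀ l ∈ u, l = a ∨ l = b) → ev u ∈ S := by
    intro u hu
    refine Subgroup.list_prod_mem _ fun x hx => ?_
    obtain ⟨l, hl, rfl⟩ := List.mem_map.1 hx
    rcases hu l hl with rfl | rfl
    · exact hw _ ha
    · exact hw _ hb
  have hcard : 60 ≤ Nat.card S := by
    have hn2 : (L.map fun d => ev d.1).Nodup := by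
      have : (L.map fun d => evc d.1) = (L.map fun d => ev d.1).map
        (fun g : A6 => List.ofFn (fun i : Fin 7 => ((g : Equiv.Perm (Fin 7)) i : ℕ))) := by
        rw [List.map_map]
        exact List.map_congr_left fun d _ => evc_eq d.1
      rw [this] at hn
      exact List.Nodup.of_map _ hn
    have h1 : ((L.map fun d => ev d.1).toFinset).card = 60 := by
      rw [List.toFinset_card_of_nodup hn2, List.length_map, hlen]
    have h2 : (((L.map fun d => ev d.1).toFinset : Finset A6) : Set A6) ⊆ (S : Set A6) := by
      intro x hx
      simp only [List.coe_toFinset, List.mem_map, Set.mem_ofPred_eq] at hx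
      obtain ⟨d, hd, rfl⟩ := hx
      exact hmem _ (hL d hd)
    have h3 := Set.ncard_le_ncard h2 (Set.toFinite _)
    rw [Set.ncard_coe_finset, h1] at h3
    exact h3
  have hidx : S.index < 10 := by
    have h1 := S.card_mul_index
    have h2 := card_A6_le
    by_contra hge
    push Not at hge
    nlinarith
  exact fixed_zero ρ hirr S (by rw [hdim]; exact hidx) w fun h hh => hh

end ops

theorem ev_rep_two : ev (rep 2) = letterA 1 := by simp [ev, rep]
theorem ev_rep_zero : ev (rep 0) = 1 := by simp [ev, rep]

theorem letter_cube : letterA 1 * letterA 1 * letterA 1 = 1 := by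
  have h : ev [1, 1, 1] = ev [] := ev_eq (by decide)
  simp only [ev, List.map_cons, List.map_nil, List.prod_cons, List.prod_nil, mul_one] at h
  rw [mul_assoc, h]

theorem letter_conj : letterA 1 * letterA 1 =
    letterA 0 * letterA 0 * (letterA 1 * (letterA 0 * letterA 0)⁻¹) := by
  have h : ev [1, 1, 0, 0] = ev [0, 0, 1] := ev_eq (by decide)
  simp only [ev, List.map_cons, List.map_nil, List.prod_cons, List.prod_nil, mul_one] at h
  rw [← mul_assoc, eq_mul_inv_iff_mul_eq, mul_assoc, mul_assoc, h]

theorem stmt8_aux {K : Type} [Field K] [CharZero K] (z : K) (hz : z ^ 2 = -1)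
    (n : ℕ) (χ : ℕ → K)
    (h0 : χ 0 = 10)
    (eH : (LH.map fun d => (1 : K) ^ (d.1.count 0) * χ d.2.1).sum = 0)
    (eη : (LH.map fun d => z ^ (d.1.count 0) * χ d.2.1).sum = 0)
    (eA : (LA.map fun d => (1 : K) ^ (d.1.count 0) * χ d.2.1).sum = 0)
    (eAt : (LAt.map fun d => (1 : K) ^ (d.1.count 0) * χ d.2.1).sum = 0)
    (eB : (LB.map fun d => (1 : K) ^ (d.1.count 0) * χ d.2.1).sum = 0)
    (eT : 10 + χ 2 + χ 2 = 3 * n) : False := by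
  have hz4 : z ^ 4 = 1 := by linear_combination (z ^ 2 - 1) * hz
  have eη' : (LH.map fun d => z ^ (d.1.count 0 % 4) * χ d.2.1).sum = 0 := by
    rw [← eη]
    congr 1
    refine List.map_congr_left fun d _ => ?_
    rw [← pow_eq_pow_mod _ hz4]
  simp only [one_pow, one_mul] at eH eA eAt eB
  simp only [LH, LA, LAt, LB, List.map_cons, List.map_nil, List.sum_cons, List.sum_nil,
    h0] at eH eA eAt eB
  simp [LH, h0] at eη'
  have eη2 : 10 - 9 * χ 1 + 4 * χ 2 + 4 * χ 3 = 0 := by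
    linear_combination eη' - (9 * χ 1 + 9 * z * χ 4) * hz
  have hc : 4 * χ 2 = -5 := by
    linear_combination (1 / 8) * (eA - eAt + eH + 2 * eη2 + (1 / 5) * (eA - eB))
  have h2 : (2 * n : K) = 5 := by linear_combination (-2 / 3) * eT + (1 / 3) * hc
  have h3 : 2 * n = 5 := by exact_mod_cast h2
  omega

set_option maxHeartbeats 1000000 in
/-- `ℚ(i)` is realized as a cyclotomic extension `K` of `ℚ`, and `i = ζ`, a
primitive 4th root of unity. -/
theorem stmt8
    (K : Type) [Field K] [Algebra ℚ K] [IsCyclotomicExtension {4} ℚ K]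
    (ζ : K) (hζ : IsPrimitiveRoot ζ 4)
    -- generators of H₁ = ⟨(3,5)(4,6), (1,2)(3,4,5,6), (1,4,6)⟩
    (x₁ x₂ x₃ : A6)
    (hx₁ : (x₁ : Equiv.Perm (Fin 7)) = c[(3 : Fin 7), 5] * c[(4 : Fin 7), 6])
    (hx₂ : (x₂ : Equiv.Perm (Fin 7)) = c[(1 : Fin 7), 2] * c[(3 : Fin 7), 4, 5, 6])
    (hx₃ : (x₃ : Equiv.Perm (Fin 7)) = c[(1 : Fin 7), 4, 6])
    -- H₁ has order 36
    (hcard : Nat.card (Subgroup.closure {x₁, x₂, x₃} : Subgroup A6) = 36)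
    -- η : the degree-1 character of H₁ with η(x₂) = i, η(x₃) = 1, η(x₁) = -1
    (η : (Subgroup.closure {x₁, x₂, x₃} : Subgroup A6) →* K)
    (hη₂ : η ⟨x₂, Subgroup.subset_closure (Set.mem_insert_of_mem _ (Set.mem_insert _ _))⟩ = ζ)
    (hη₃ : η ⟨x₃, Subgroup.subset_closure
      (Set.mem_insert_of_mem _ (Set.mem_insert_of_mem _ rfl))⟩ = 1)
    (hη₁ : η ⟨x₁, Subgroup.subset_closure (Set.mem_insert _ _)⟩ = -1)
    -- the irreducible character of A₆ of degree 10
    (V : FDRep K A6) (hV : CategoryTheory.Simple V) (hdim : Module.finrank K V = 10) :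
    ∀ g : A6, V.character g = indChar (Subgroup.closure {x₁, x₂, x₃}) η g := by
  have : CharZero K := algebraRat.charZero K
  have hirr := simple_sub V hV
  have hζ2 : ζ ^ 2 = -1 := by
    have h1 : (ζ ^ 2 - 1) * (ζ ^ 2 + 1) = 0 := by linear_combination hζ.pow_eq_one
    rcases mul_eq_zero.1 h1 with h | h
    · exact absurd (sub_eq_zero.1 h) (hζ.pow_ne_one_of_pos_of_lt (by norm_num) (by norm_num))
    · linear_combination h
  have e2 : x₂ = letterA 0 := Subtype.ext hx₂
  have e3 : x₃ = letterA 1 := Subtype.ext hx₃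
  have e1 : x₁ = x₂ * x₂ := by
    apply Subtype.ext
    rw [Subgroup.coe_mul, hx₁, hx₂]
    decide +kernel
  have hidx : (Subgroup.closure {x₁, x₂, x₃} : Subgroup A6).index ≤ 10 := by
    have h1 := (Subgroup.closure {x₁, x₂, x₃} : Subgroup A6).card_mul_index
    have h2 := card_A6_le
    rw [hcard] at h1
    omega
  have hz4 : (-ζ) ^ 4 = 1 := by linear_combination hζ.pow_eq_one
  by_cases hη : op V.ρ (-ζ) LH = 0
  · exfalso
    have hfix : op V.ρ 1 LH = 0 := by
      ext v
      have hw : ∀ l, chkPerm l LH = true → V.ρ (letterA l) (op V.ρ 1 LH v) = op V.ρ 1 LH v := by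
        intro l hl
        have := op_letter V.ρ 1 (one_pow 4) LH l hl
        rw [one_pow, one_smul] at this
        exact congrArg (fun f => f v) this
      have hw2 := hw 0 perm_LH0
      have hw3 := hw 1 perm_LH1
      generalize op V.ρ 1 LH v = w at hw2 hw3
      have hall : ∀ h ∈ (Subgroup.closure {x₁, x₂, x₃} : Subgroup A6), V.ρ h w = w := by
        intro h hh
        induction hh using Subgroup.closure_induction with
        | mem x hx =>
          rcases hx with rfl | rfl | rfl
          · rw [e1, e2, map_mul, Module.End.mul_apply, hw2, hw2]
          · rw [e2, hw2]
          · rw [e3, hw3]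
        | one => simp
        | mul x y _ _ hx hy => rw [map_mul, Module.End.mul_apply, hy, hx]
        | inv x _ hx => conv_lhs => rw [← hx]
                        simp
      rcases hidx.lt_or_eq with hlt | heq
      · exact fixed_zero V.ρ hirr (Subgroup.closure {x₁, x₂, x₃} : Subgroup A6) (by rw [hdim]; exact hlt) w hall
      · exact fixed_zero' V.ρ hirr (Subgroup.closure {x₁, x₂, x₃} : Subgroup A6) (by rw [hdim, heq]) (by rw [hdim]; norm_num) w hall
    have zA := op_zero V.ρ hirr hdim LA 2 3 perm_LA2 perm_LA3 let_LA nodup_LA rfl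
    have zAt := op_zero V.ρ hirr hdim LAt 2 3 perm_LAt2 perm_LAt3 let_LAt nodup_LAt rfl
    have zB := op_zero V.ρ hirr hdim LB 2 4 perm_LB2 perm_LB4 let_LB nodup_LB rfl
    obtain ⟨n, hn⟩ := trace_three V.ρ (letterA 1) letter_cube
    refine stmt8_aux (-ζ) (by linear_combination hζ2) n
      (fun k => LinearMap.trace K V (V.ρ (ev (rep k)))) ?_ (trace_op V.ρ 1 [] LH conj_LH hfix)
      (trace_op V.ρ (-ζ) [] LH conj_LH hη) (trace_op V.ρ 1 [] LA conj_LA zA)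
      (trace_op V.ρ 1 [0] LAt conj_LAt zAt) (trace_op V.ρ 1 [] LB conj_LB zB) ?_
    · rw [ev_rep_zero, map_one, LinearMap.trace_one, hdim]; norm_num
    · rw [hdim] at hn
      have r2 : ev (rep 2) = letterA 1 := ev_rep_two
      have r4 : LinearMap.trace K V (V.ρ (letterA 1 * letterA 1))
          = LinearMap.trace K V (V.ρ (letterA 1)) := by
        rw [letter_conj, map_mul, LinearMap.trace_mul_comm, ← map_mul, inv_mul_cancel_right]
      rw [r4] at hn
      simp only [r2]
      exact_mod_cast hn
  · obtain ⟨v, hv⟩ : ∃ v, op V.ρ (-ζ) LH v ≠ 0 := by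
      by_contra hcon
      push Not at hcon
      exact hη (LinearMap.ext hcon)
    have hw2 : V.ρ (letterA 0) (op V.ρ (-ζ) LH v) = ζ • op V.ρ (-ζ) LH v := by
      have h := congrArg (fun f => f v) (op_letter V.ρ (-ζ) hz4 LH 0 perm_LH0)
      have h' : (-ζ) • V.ρ (letterA 0) (op V.ρ (-ζ) LH v) = op V.ρ (-ζ) LH v := by
        simpa using h
      conv_rhs => rw [← h', smul_smul]
      have : ζ * -ζ = 1 := by linear_combination -hζ2
      rw [this, one_smul]
    have hw3 : V.ρ (letterA 1) (op V.ρ (-ζ) LH v) = op V.ρ (-ζ) LH v := by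
      have h := congrArg (fun f => f v) (op_letter V.ρ (-ζ) hz4 LH 1 perm_LH1)
      simpa using h
    generalize op V.ρ (-ζ) LH v = w at hv hw2 hw3
    have hall : ∀ h, ∀ hh : h ∈ (Subgroup.closure {x₁, x₂, x₃} : Subgroup A6), V.ρ h w = η ⟨h, hh⟩ • w := by
      intro h hh
      induction hh using Subgroup.closure_induction with
      | mem x hx =>
        rcases hx with rfl | rfl | rfl
        · rw [hη₁, e1, e2, map_mul, Module.End.mul_apply, hw2, map_smul, hw2, smul_smul, ← hζ2, sq]
        · rw [hη₂, e2, hw2]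
        · rw [hη₃, e3, hw3, one_smul]
      | one =>
        have : η ⟨1, (Subgroup.closure {x₁, x₂, x₃} : Subgroup A6).one_mem⟩ = 1 := map_one η
        rw [this]; simp
      | mul x y hx hy ihx ihy =>
        have : η ⟨x * y, (Subgroup.closure {x₁, x₂, x₃} : Subgroup A6).mul_mem hx hy⟩ = η ⟨x, hx⟩ * η ⟨y, hy⟩ := map_mul η ⟨x, hx⟩ ⟨y, hy⟩
        rw [this, map_mul, Module.End.mul_apply, ihy, map_smul, ihx, smul_smul, mul_comm]
      | inv x hx ih =>
        have : η ⟨x⁻¹, (Subgroup.closure {x₁, x₂, x₃} : Subgroup A6).inv_mem hx⟩ * η ⟨x, hx⟩ = 1 := by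
          rw [← map_mul]
          have : (⟨x⁻¹, (Subgroup.closure {x₁, x₂, x₃} : Subgroup A6).inv_mem hx⟩ * ⟨x, hx⟩ : (Subgroup.closure {x₁, x₂, x₃} : Subgroup A6)) = 1 := Subtype.ext (by simp)
          rw [this, map_one]
        have h2 : V.ρ x⁻¹ (V.ρ x w) = w := by simp
        rw [ih, map_smul] at h2
        conv_rhs => rw [← h2, smul_smul, this, one_smul]
    have hge := finrank_le_index V.ρ hirr (Subgroup.closure {x₁, x₂, x₃} : Subgroup A6) η w hv (fun h => hall h h.2)
    intro g
    exact ind_trace V.ρ hirr (Subgroup.closure {x₁, x₂, x₃} : Subgroup A6) η w hv (fun h => hall h h.2) (by omega) g
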